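/- arXiv:2008.05152 — 2 statements merged into one kernel-verified Lean document; each statement's English description precedes it below -/
import Mathlib

section
/- Let (X,d) be a complete metric space that is metric doubling and relatively K ball connected for some K > 1. Let x₀ ∈ X and A ≥ 8. Then there exists a collection {Q_{k,i} : k ∈ ℤ, i ∈ I_k ⊆ ℤ₊} of Borel subsets of X such that, setting c_A = 1/2 − 1/(A−1) and C_A = A/(A−1): (a) for every k ∈ ℤ, X = ∪_{i ∈ I_k} Q_{k,i} and Q_{k,i} ∩ Q_{k,j} = ∅ for all distinct i, j ∈ I_k; (b) if m ≤ n, i ∈ I_n and j ∈ I_m, then either Q_{n,i} ∩ Q_{m,j} = ∅ or Q_{n,i} ⊆ Q_{m,j}; (c) for every k and i ∈ I_k there exists x_{k,i} ∈ Q_{k,i} with B(x_{k,i}, c_A·A^{−k}) ⊆ Q_{k,i} ⊆ closure(B(x_{k,i}, C_A·A^{−k})); (d) the nets N_k = {x_{k,i} : i ∈ I_k} satisfy N_k ⊆ N_{k+1} for all k ∈ ℤ, and x₀ ∈ N_k for all k; (e) there exists a constant C_M = C_M(A) such that each cube Q_{k,i} contains at most C_M of the cubes Q_{k+1,j}, and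 every cube Q_{k+1,j} contained in Q_{k,i} has its center x_{k+1,j} within distance A^{−k} of x_{k,i}; (f) setting k₀ = inf{ k ∈ ℤ : |I_k| > 1 } ∈ ℤ ∪ {−∞}, one has c_A·A^{−k₀} ≤ diam(X,d) ≤ 2·C_A·A^{1−k₀} when k₀ ∈ ℤ, and for every integer k ≥ k₀ each cube Q_{k,i} contains at least two cubes of generation k+1; (g) for every k ∈ ℤ, the set Q_{k,0} is compact and x_{k,0} = x₀. -/
/-- The chain condition at scale `ε` within dilation factor `K`, with chains of length `N`. -/
def ChainCond (X : Type*) [MetricSpace X] (ε K : ℝ) (N : ℕ) : Prop :=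
  ∀ (x₀ : X) (R : ℝ), 0 < R →
    ∀ x ∈ closure (Metric.ball x₀ R), ∀ y ∈ closure (Metric.ball x₀ R),
      ∃ z : ℕ → X, z 0 = x ∧ z N = y ∧
        (∀ i ≤ N, Metric.ball (z i) (ε * R) ⊆ Metric.ball x₀ (K * R)) ∧
        ∀ i, 1 ≤ i → i ≤ N → dist (z (i - 1)) (z i) < ε * R

/-- Relative `K` ball connectedness. -/
def IsRBC (X : Type*) [MetricSpace X] (K : ℝ) : Prop :=
  ∀ ε ∈ Set.Ioo (0:ℝ) 1, ∃ N : ℕ, ChainCond X ε K N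

/-- Metric doubling. -/
def MetricDoubling (X : Type*) [MetricSpace X] : Prop :=
  ∃ N : ℕ, 2 ≤ N ∧ ∀ (x : X) (R : ℝ), 0 < R → ∃ z : Fin N → X,
    Metric.ball x R ⊆ ⋃ i, Metric.ball (z i) (R / 2)

namespace DyadicCubes

open Set Metric

theorem exists_label {X : Type*} {U : Set X} (hU : U.Countable) (x₀ : X) :
    ∃ e : X → ℕ, InjOn e U ∧ e x₀ = 0 ∧ ∀ x, x ≠ x₀ → e x₀ < e x := by
  classical
  obtain ⟨f, hf⟩ := countable_iff_exists_injOn.1 hU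
  refine ⟨fun x => if x = x₀ then 0 else f x + 1, fun x hx y hy hxy => ?_, by simp,
    fun x hx => by simp [hx]⟩
  by_cases h1 : x = x₀ <;> by_cases h2 : y = x₀ <;> simp [h1, h2] at hxy ⊢
  exact hf hx hy hxy

variable {X : Type*} [MetricSpace X]

section Nets

theorem exists_maximal_separated {B U : Set X} {r : ℝ} (hr : 0 < r) (hBU : B ⊆ U)
    (hB : B.Pairwise fun x y => r ≤ dist x y) :
    ∃ M : Set X, B ⊆ M ∧ M ⊆ U ∧ (M.Pairwise fun x y => r ≤ dist x y) ∧
      ∀ u ∈ U, ∃ m ∈ M, dist u m < r := by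
  obtain ⟨M, hBM, hM⟩ := zorn_subset_nonempty
    {M : Set X | M ⊆ U ∧ M.Pairwise fun x y => r ≤ dist x y}
    (fun c hc hchain _ => ⟨⋃₀ c, ⟨sUnion_subset fun s hs => (hc hs).1,
      (pairwise_sUnion hchain.directedOn).2 fun s hs => (hc hs).2⟩,
      fun s hs => subset_sUnion_of_mem hs⟩) B ⟨hBU, hB⟩
  refine ⟨M, hBM, hM.prop.1, hM.prop.2, fun u hu => ?_⟩
  by_contra! hfar
  have hins : insert u M ∈ {M : Set X | M ⊆ U ∧ M.Pairwise fun x y => r ≤ dist x y} := by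
    refine ⟨insert_subset hu hM.prop.1, hM.prop.2.insert fun b hb _ => ⟨hfar b hb, ?_⟩⟩
    rw [dist_comm]
    exact hfar b hb
  have huM : u ∈ M := hM.le_of_ge hins (subset_insert u M) (mem_insert u M)
  have := hfar u huM
  rw [dist_self] at this
  linarith

/-- Nested nets at the scales `A ^ (-k)` through a base point. -/
structure IsDyadicNet (N : ℤ → Set X) (x₀ : X) (A : ℝ) : Prop where
  base_mem : ∀ k, x₀ ∈ N k
  subset_succ : ∀ k, N k ⊆ N (k + 1)
  separated : ∀ k, (N k).Pairwise fun x y => A ^ (-k) ≤ dist x y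
  cover : ∀ k, ∀ p ∈ N (k + 1), ∃ y ∈ N k, dist p y ≤ A ^ (-k)
  dense : ∀ (k : ℤ) (p : X) (ε : ℝ), 0 < ε → ∃ l, k ≤ l ∧ ∃ y ∈ N l, dist p y < ε

theorem exists_isDyadicNet (x₀ : X) {A : ℝ} (hA : 1 < A) :
    ∃ N : ℤ → Set X, IsDyadicNet N x₀ A := by
  have hA0 : 0 < A := by linarith
  have key : ∀ (B U : Set X) (r : ℝ), ∃ M : Set X, 0 < r → B ⊆ U →
      (B.Pairwise fun x y => r ≤ dist x y) → B ⊆ M ∧ M ⊆ U ∧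
      (M.Pairwise fun x y => r ≤ dist x y) ∧ ∀ u ∈ U, ∃ m ∈ M, dist u m < r := by
    intro B U r
    by_cases h : 0 < r ∧ B ⊆ U ∧ B.Pairwise fun x y => r ≤ dist x y
    · obtain ⟨M, hM⟩ := exists_maximal_separated h.1 h.2.1 h.2.2
      exact ⟨M, fun _ _ _ => hM⟩
    · exact ⟨∅, fun h1 h2 h3 => absurd ⟨h1, h2, h3⟩ h⟩
  choose f hf using key
  let T : ℕ → Set X := fun n => Nat.rec (f {x₀} univ 1)
    (fun m s => f s univ (A ^ (-((m : ℤ) + 1)))) n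
  let S : ℕ → Set X := fun n => Nat.rec (f {x₀} univ 1)
    (fun m s => f {x₀} s (A ^ ((m : ℤ) + 1))) n
  have hpos : ∀ k : ℤ, 0 < A ^ k := fun k => zpow_pos hA0 k
  have h0 := hf {x₀} univ 1 one_pos (subset_univ _) (pairwise_singleton _ _)
  have hT : ∀ n : ℕ, (T n).Pairwise fun x y => A ^ (-(n : ℤ)) ≤ dist x y := by
    intro n
    induction n with
    | zero =>
      rw [Nat.cast_zero, neg_zero, zpow_zero]
      exact h0.2.2.1
    | succ m ih =>
      have := (hf (T m) univ (A ^ (-((m : ℤ) + 1))) (hpos _) (subset_univ _)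
        (ih.mono' fun x y h => le_trans (zpow_le_zpow_right₀ hA.le (by lia)) h)).2.2.1
      rw [Nat.cast_succ]
      exact this
  have hTs : ∀ m : ℕ, T m ⊆ T (m + 1) ∧ ∀ u, ∃ y ∈ T (m + 1), dist u y < A ^ (-((m : ℤ) + 1)) := by
    intro m
    have := hf (T m) univ (A ^ (-((m : ℤ) + 1))) (hpos _) (subset_univ _)
        ((hT m).mono' fun x y h => le_trans (zpow_le_zpow_right₀ hA.le (by lia)) h)
    exact ⟨this.1, fun u => this.2.2.2 u (mem_univ _)⟩
  have hTc : ∀ (n : ℕ) (u : X), ∃ y ∈ T n, dist u y < A ^ (-(n : ℤ)) := by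
    intro n u
    cases n with
    | zero =>
      rw [Nat.cast_zero, neg_zero, zpow_zero]
      exact h0.2.2.2 u (mem_univ _)
    | succ m =>
      rw [Nat.cast_succ]
      exact (hTs m).2 u
  have hTb : ∀ n : ℕ, x₀ ∈ T n := by
    intro n
    induction n with
    | zero => exact h0.1 rfl
    | succ m ih => exact (hTs m).1 ih
  have hSb : ∀ n : ℕ, x₀ ∈ S n := by
    intro n
    induction n with
    | zero => exact h0.1 rfl
    | succ m ih => exact (hf {x₀} (S m) (A ^ ((m : ℤ) + 1)) (hpos _)
        (singleton_subset_iff.2 ih) (pairwise_singleton _ _)).1 rfl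
  have hSs := fun m : ℕ => (hf {x₀} (S m) (A ^ ((m : ℤ) + 1)) (hpos _)
        (singleton_subset_iff.2 (hSb m)) (pairwise_singleton _ _)).2
  let N : ℤ → Set X := fun k => if 0 ≤ k then T k.toNat else S (-k).toNat
  have hNT : ∀ n : ℕ, N n = T n := fun n => by simp [N]
  have hNS : ∀ n : ℕ, N (-((n : ℤ) + 1)) = S (n + 1) := fun n => by
    have h1 : ¬ (0 ≤ -((n : ℤ) + 1)) := by lia
    have h2 : (-(-((n : ℤ) + 1))).toNat = n + 1 := by lia
    simp only [N, if_neg h1, h2]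
  have hNS' : ∀ n : ℕ, N (-((n : ℤ) + 1) + 1) = S n := fun n => by
    cases n with
    | zero => exact (congrArg N (by simp)).trans (hNT 0)
    | succ m =>
      rw [← hNS m]
      congr 1
  have hcases : ∀ k : ℤ, (∃ n : ℕ, k = n) ∨ ∃ n : ℕ, k = -((n : ℤ) + 1) := by
    intro k
    rcases le_or_gt 0 k with h | h
    · exact Or.inl ⟨k.toNat, by lia⟩
    · exact Or.inr ⟨(-k - 1).toNat, by lia⟩
  refine ⟨N, ?_, ?_, ?_, ?_, ?_⟩
  · intro k
    obtain ⟨n, rfl⟩ | ⟨n, rfl⟩ := hcases k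
    · rw [hNT]; exact hTb n
    · rw [hNS]; exact hSb (n + 1)
  · intro k
    obtain ⟨n, rfl⟩ | ⟨n, rfl⟩ := hcases k
    · have := hNT (n + 1)
      push_cast at this
      rw [hNT, this]; exact (hTs n).1
    · rw [hNS, hNS']; exact (hSs n).1
  · intro k
    obtain ⟨n, rfl⟩ | ⟨n, rfl⟩ := hcases k
    · rw [hNT]; exact hT n
    · rw [hNS, neg_neg]; exact (hSs n).2.1
  · intro k p hp
    obtain ⟨n, rfl⟩ | ⟨n, rfl⟩ := hcases k
    · rw [hNT]
      obtain ⟨y, hy, h⟩ := hTc n p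
      exact ⟨y, hy, h.le⟩
    · rw [hNS, neg_neg]
      rw [hNS'] at hp
      obtain ⟨y, hy, h⟩ := (hSs n).2.2 p hp
      exact ⟨y, hy, h.le⟩
  · intro k p ε hε
    obtain ⟨n, hn⟩ := exists_pow_lt_of_lt_one hε (inv_lt_one_of_one_lt₀ hA)
    obtain ⟨y, hy, h⟩ := hTc (max n k.toNat) p
    refine ⟨(max n k.toNat : ℕ), by lia, y, by rw [hNT]; exact hy, h.trans (lt_of_le_of_lt ?_ hn)⟩
    rw [inv_pow, ← zpow_natCast, ← zpow_neg]
    exact zpow_le_zpow_right₀ hA.le (by lia)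

end Nets

section Doubling

theorem exists_finset_cover (h : MetricDoubling X) :
    ∃ N : ℕ, ∀ (n : ℕ) (x : X) (R : ℝ), 0 < R →
      ∃ F : Finset X, F.card ≤ N ^ n ∧ ball x R ⊆ ⋃ z ∈ F, ball z (R / 2 ^ n) := by
  classical
  obtain ⟨N, -, hN⟩ := h
  refine ⟨N, fun n => ?_⟩
  induction n with
  | zero => exact fun x R _ => ⟨{x}, by simp⟩
  | succ n ih =>
    intro x R hR
    obtain ⟨F, hF, hcov⟩ := ih x R hR
    choose g hg using fun z => hN z (R / 2 ^ n) (by positivity)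
    refine ⟨F.biUnion fun z => Finset.univ.image (g z), ?_, ?_⟩
    · calc _ ≤ F.card * N := Finset.card_biUnion_le_card_mul _ _ _ fun z _ =>
            Finset.card_image_le.trans (by simp)
        _ ≤ N ^ (n + 1) := by rw [pow_succ]; gcongr
    · intro y hy
      obtain ⟨z, hz, hyz⟩ := mem_iUnion₂.1 (hcov hy)
      obtain ⟨i, hi⟩ := mem_iUnion.1 (hg z hyz)
      refine mem_iUnion₂.2 ⟨g z i, Finset.mem_biUnion.2 ⟨z, hz, by simp⟩, ?_⟩
      rwa [pow_succ, ← div_div]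

theorem exists_packing_bound (h : MetricDoubling X) :
    ∃ N : ℕ, ∀ (n : ℕ) (x : X) (R s : ℝ) (S : Set X), 0 < R →
      (S.Pairwise fun x y => s ≤ dist x y) → 2 * (R / 2 ^ n) ≤ s →
      (S ∩ ball x R).encard ≤ (N ^ n : ℕ) := by
  obtain ⟨N, hN⟩ := exists_finset_cover h
  refine ⟨N, fun n x R s S hR hS hs => ?_⟩
  obtain ⟨F, hF, hcov⟩ := hN n x R hR
  have hex : ∀ y, ∃ z, y ∈ S ∩ ball x R → z ∈ F ∧ y ∈ ball z (R / 2 ^ n) := by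
    intro y
    by_cases hy : y ∈ S ∩ ball x R
    · obtain ⟨z, hz, hyz⟩ := mem_iUnion₂.1 (hcov hy.2)
      exact ⟨z, fun _ => ⟨hz, hyz⟩⟩
    · exact ⟨y, fun h => absurd h hy⟩
  choose g hg using hex
  calc (S ∩ ball x R).encard ≤ (F : Set X).encard := by
        refine encard_le_encard_of_injOn (f := g) (fun y hy => (hg y hy).1) ?_
        intro y hy y' hy' heq
        by_contra hne
        have h1 := mem_ball.1 (hg y hy).2
        have h2 := mem_ball'.1 (hg y' hy').2
        rw [← heq] at h2
        linarith [hS hy.1 hy'.1 hne, dist_triangle y (g y) y']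
    _ ≤ _ := by
        rw [encard_coe_eq_coe_finsetCard]
        exact_mod_cast hF

theorem finite_inter_closedBall (h : MetricDoubling X) {S : Set X} {s : ℝ} (hs : 0 < s)
    (hS : S.Pairwise fun x y => s ≤ dist x y) (x : X) (R : ℝ) : (S ∩ closedBall x R).Finite := by
  obtain ⟨N, hN⟩ := exists_packing_bound h
  have hR : 0 < |R| + 1 := by positivity
  obtain ⟨n, hn⟩ := pow_unbounded_of_one_lt (2 * (|R| + 1) / s) one_lt_two
  have hb := hN n x (|R| + 1) s S hR hS (by
    rw [div_lt_iff₀ hs] at hn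
    rw [← mul_div_assoc, div_le_iff₀ (by positivity)]
    linarith)
  refine (finite_of_encard_le_coe hb).subset (inter_subset_inter_right _ ?_)
  exact closedBall_subset_ball (by linarith [le_abs_self R])

theorem properSpace_of_metricDoubling [CompleteSpace X] (h : MetricDoubling X) :
    ProperSpace X := by
  obtain ⟨N, hN⟩ := exists_finset_cover h
  refine ⟨fun x R => TotallyBounded.isCompact_of_isClosed ?_ isClosed_closedBall⟩
  refine Metric.totallyBounded_iff.2 fun ε hε => ?_
  have hR : 0 < |R| + 1 := by positivity
  obtain ⟨n, hn⟩ := pow_unbounded_of_one_lt ((|R| + 1) / ε) one_lt_two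
  obtain ⟨F, -, hF⟩ := hN n x (|R| + 1) hR
  refine ⟨F, F.finite_toSet, ?_⟩
  refine (closedBall_subset_ball (by linarith [le_abs_self R])).trans (hF.trans ?_)
  refine iUnion₂_mono fun z _ => ball_subset_ball ?_
  rw [div_lt_iff₀ hε] at hn
  rw [div_le_iff₀ (by positivity)]
  linarith

end Doubling

section Connected

theorem exists_dist_mem_Ico {K : ℝ} (h : IsRBC X K) {x y : X} {t δ : ℝ} (ht : 0 < t)
    (hδ : 0 < δ) (hxy : t ≤ dist x y) : ∃ z, t ≤ dist x z ∧ dist x z < t + δ := by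
  have hR : 0 < dist x y + δ := by positivity
  obtain ⟨N, hN⟩ := h (δ / (dist x y + δ)) ⟨by positivity, by
    rw [div_lt_one hR]; linarith⟩
  obtain ⟨z, hz0, hzN, -, hstep⟩ := hN x (dist x y + δ) hR x
    (subset_closure (mem_ball_self hR)) y (subset_closure (by rw [mem_ball']; linarith))
  rw [div_mul_cancel₀ _ hR.ne'] at hstep
  classical
  have hex : ∃ i, t ≤ dist x (z i) := ⟨N, by rwa [hzN]⟩
  refine ⟨z (Nat.find hex), Nat.find_spec hex, ?_⟩
  have hle : Nat.find hex ≤ N := Nat.find_min' hex (by rwa [hzN])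
  have hpos : 1 ≤ Nat.find hex := by
    rw [Nat.one_le_iff_ne_zero]
    intro h0
    have := Nat.find_spec hex
    rw [h0, hz0, dist_self] at this
    linarith
  have h1 := hstep _ hpos hle
  have h2 := not_le.1 (Nat.find_min hex (m := Nat.find hex - 1) (by lia))
  linarith [dist_triangle x (z (Nat.find hex - 1)) (z (Nat.find hex))]

end Connected

section Cubes

/-- A choice, for every generation `k` and every point, of a nearest point of the net `N k`. -/
structure IsNearest (N : ℤ → Set X) (π : ℤ → X → X) : Prop where
  mem : ∀ k p, π k p ∈ N k
  dist_le : ∀ k p, ∀ y ∈ N k, dist p (π k p) ≤ dist p y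

theorem exists_isNearest {N : ℤ → Set X} (hne : ∀ k, (N k).Nonempty)
    (hfin : ∀ k p R, (N k ∩ closedBall p R).Finite) : ∃ π, IsNearest N π := by
  have key : ∀ k p, ∃ z ∈ N k, ∀ y ∈ N k, dist p z ≤ dist p y := by
    intro k p
    obtain ⟨a, ha⟩ := hne k
    obtain ⟨z, hz, hmin⟩ := exists_min_image _ (dist p) (hfin k p (dist p a))
      ⟨a, ha, by rw [mem_closedBall']⟩
    refine ⟨z, hz.1, fun y hy => ?_⟩
    rcases le_total (dist p y) (dist p a) with h | h
    · exact hmin y ⟨hy, by rwa [mem_closedBall']⟩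
    · exact (hmin a ⟨ha, by rw [mem_closedBall']⟩).trans h
  choose π hπ hπ' using key
  exact ⟨π, hπ, hπ'⟩

/-- `Desc N π k x y`: iterated choice of nearest points takes the net point `y` to the point `x`
of generation `k`. -/
inductive Desc (N : ℤ → Set X) (π : ℤ → X → X) : ℤ → X → X → Prop
  | refl {k : ℤ} {x : X} (hx : x ∈ N k) : Desc N π k x x
  | parent {k : ℤ} {w y : X} (hw : w ∈ N (k + 1)) (h : Desc N π (k + 1) w y) :
      Desc N π k (π k w) y

/-- The closed cube of generation `k` around `x`. -/
def closedCube (N : ℤ → Set X) (π : ℤ → X → X) (k : ℤ) (x : X) : Set X :=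
  closure {y | Desc N π k x y}

/-- `InCube N π e x₀ k x p`: the point `p` is assigned to the cube of generation `k` around `x`.
Cubes around `x₀` are closed; inside a cube, the child with the least label takes precedence. -/
inductive InCube (N : ℤ → Set X) (π : ℤ → X → X) (e : X → ℕ) (x₀ : X) : ℤ → X → X → Prop
  | base {k : ℤ} {p : X} (h : p ∈ closedCube N π k x₀) : InCube N π e x₀ k x₀ p
  | child {k l : ℤ} {w p : X} (hl : l = k + 1) (hw : w ∈ N l)
      (hp : InCube N π e x₀ k (π k w) p) (hpw : p ∈ closedCube N π l w)
      (hmin : ∀ v ∈ N l, π k v = π k w → e v < e w → p ∉ closedCube N π l v) :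
      InCube N π e x₀ l w p

variable {N : ℤ → Set X} {π : ℤ → X → X} {x₀ : X} {A : ℝ} {e : X → ℕ}

theorem IsNearest.eq_self (hπ : IsNearest N π) {k : ℤ} {x : X} (hx : x ∈ N k) : π k x = x := by
  have := hπ.dist_le k x x hx
  rw [dist_self] at this
  exact (dist_le_zero.1 this).symm

theorem Desc.mem (hπ : IsNearest N π) {k : ℤ} {x y : X} (h : Desc N π k x y) : x ∈ N k := by
  cases h with
  | refl hx => exact hx
  | parent _ _ => exact hπ.mem _ _

theorem IsDyadicNet.dist_parent_le (hN : IsDyadicNet N x₀ A) (hπ : IsNearest N π) {k : ℤ}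
    {w : X} (hw : w ∈ N (k + 1)) : dist w (π k w) ≤ A ^ (-k) := by
  obtain ⟨y, hy, h⟩ := hN.cover k w hw
  exact (hπ.dist_le k w y hy).trans h

theorem zpow_neg_succ (hA : 1 < A) (k : ℤ) : A ^ (-(k + 1)) = A ^ (-k) / A := by
  rw [neg_add, ← sub_eq_add_neg, zpow_sub_one₀ (by linarith), div_eq_mul_inv]

theorem outer_radius_succ (hA : 1 < A) (k : ℤ) :
    A / (A - 1) * A ^ (-(k + 1)) = 1 / (A - 1) * A ^ (-k) := by
  have : A ≠ 0 := by linarith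
  have : A - 1 ≠ 0 := by linarith
  rw [zpow_neg_succ hA]
  field_simp

theorem outer_radius_eq (hA : 1 < A) (k : ℤ) :
    A / (A - 1) * A ^ (-k) = A ^ (-k) + 1 / (A - 1) * A ^ (-k) := by
  have : A - 1 ≠ 0 := by linarith
  field_simp
  ring

theorem Desc.dist_lt (hN : IsDyadicNet N x₀ A) (hπ : IsNearest N π) (hA : 1 < A) {k : ℤ}
    {x y : X} (h : Desc N π k x y) : dist x y < A / (A - 1) * A ^ (-k) := by
  have hA1 : 0 < A - 1 := by linarith
  induction h with
  | refl hx =>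
    rw [dist_self]
    positivity
  | @parent k w y hw _ ih =>
    rw [outer_radius_succ hA] at ih
    rw [outer_radius_eq hA]
    have h1 := hN.dist_parent_le hπ hw
    rw [dist_comm] at h1
    linarith [dist_triangle (π k w) w y]

theorem closedCube_subset (hN : IsDyadicNet N x₀ A) (hπ : IsNearest N π) (hA : 1 < A) (k : ℤ)
    (x : X) : closedCube N π k x ⊆ closure (ball x (A / (A - 1) * A ^ (-k))) :=
  closure_mono fun _ hy => mem_ball'.2 (Desc.dist_lt hN hπ hA hy)

theorem dist_le_of_mem_closedCube (hN : IsDyadicNet N x₀ A) (hπ : IsNearest N π) (hA : 1 < A)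
    {k : ℤ} {x p : X} (h : p ∈ closedCube N π k x) : dist p x ≤ A / (A - 1) * A ^ (-k) :=
  closure_ball_subset_closedBall (closedCube_subset hN hπ hA k x h)

theorem mem_of_mem_closedCube (hπ : IsNearest N π) {k : ℤ} {x p : X}
    (h : p ∈ closedCube N π k x) : x ∈ N k := by
  obtain ⟨y, hy⟩ := closure_nonempty_iff.1 ⟨p, h⟩
  exact Desc.mem hπ hy

theorem closedCube_subset_parent {k : ℤ} {w : X} (hw : w ∈ N (k + 1)) :
    closedCube N π (k + 1) w ⊆ closedCube N π k (π k w) :=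
  closure_mono fun _ hy => Desc.parent hw hy

theorem half_le_dist (hN : IsDyadicNet N x₀ A) (hπ : IsNearest N π) {k : ℤ} {x w : X}
    (hx : x ∈ N k) (h : π k w ≠ x) : A ^ (-k) / 2 ≤ dist w x := by
  have h1 := hπ.dist_le k w x hx
  have h2 := hN.separated k (hπ.mem k w) hx h
  have h3 := dist_triangle_left (π k w) x w
  linarith

theorem Desc.le_dist_of_ne (hN : IsDyadicNet N x₀ A) (hπ : IsNearest N π) (hA : 1 < A) {k : ℤ}
    {x y z : X} (h : Desc N π k z y) (hx : x ∈ N k) (hne : z ≠ x) :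
    (1 / 2 - 1 / (A - 1)) * A ^ (-k) ≤ dist y x := by
  have hA1 : 0 < A - 1 := by linarith
  have hp : 0 < A ^ (-k) := zpow_pos (by linarith) _
  have hq : 0 < 1 / (A - 1) * A ^ (-k) := by positivity
  cases h with
  | refl hz => linarith [hN.separated k hz hx hne]
  | @parent _ w _ hw hd =>
    have h1 := half_le_dist hN hπ hx hne
    have h2 := Desc.dist_lt hN hπ hA hd
    rw [outer_radius_succ hA] at h2
    linarith [dist_triangle w y x]

theorem eq_of_mem_closedCube_of_mem_ball (hN : IsDyadicNet N x₀ A) (hπ : IsNearest N π)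
    (hA : 1 < A) {k : ℤ} {x p z : X} (hx : x ∈ N k)
    (hp : p ∈ ball x ((1 / 2 - 1 / (A - 1)) * A ^ (-k))) (hz : p ∈ closedCube N π k z) :
    z = x := by
  by_contra hne
  obtain ⟨y, hy, hyz⟩ := mem_closure_iff.1 hz _ isOpen_ball hp
  exact (Desc.le_dist_of_ne hN hπ hA hyz hx hne).not_gt hy

theorem IsDyadicNet.exists_desc (hπ : IsNearest N π) {k l : ℤ} (hkl : k ≤ l) {y : X}
    (hy : y ∈ N l) : ∃ z, Desc N π k z y := by
  have key : ∀ n : ℕ, ∃ z, Desc N π (l - n) z y := by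
    intro n
    induction n with
    | zero => exact ⟨y, Desc.refl (by simpa using hy)⟩
    | succ n ih =>
      obtain ⟨z, hz⟩ := ih
      have h1 : l - (n : ℤ) = l - ((n + 1 : ℕ) : ℤ) + 1 := by lia
      rw [h1] at hz
      exact ⟨_, Desc.parent (Desc.mem hπ hz) hz⟩
  obtain ⟨z, hz⟩ := key (l - k).toNat
  exact ⟨z, by rwa [show l - ((l - k).toNat : ℤ) = k by lia] at hz⟩

theorem exists_mem_closedCube (hN : IsDyadicNet N x₀ A) (hπ : IsNearest N π) (hA : 1 < A)
    (hfin : ∀ k p R, (N k ∩ closedBall p R).Finite) (k : ℤ) (p : X) :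
    ∃ z, p ∈ closedCube N π k z := by
  have hF := hfin k p (1 + A / (A - 1) * A ^ (-k))
  have hcl : p ∈ closure (⋃ z ∈ N k ∩ closedBall p (1 + A / (A - 1) * A ^ (-k)),
      {y | Desc N π k z y}) := by
    refine Metric.mem_closure_iff.2 fun ε hε => ?_
    obtain ⟨l, hl, y, hy, hpy⟩ := hN.dense k p (min ε 1) (lt_min hε one_pos)
    obtain ⟨z, hz⟩ := IsDyadicNet.exists_desc hπ hl hy
    refine ⟨y, mem_iUnion₂.2 ⟨z, ⟨Desc.mem hπ hz, mem_closedBall.2 ?_⟩, hz⟩,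
      hpy.trans_le (min_le_left _ _)⟩
    have h1 := Desc.dist_lt hN hπ hA hz
    have h2 := hpy.trans_le (min_le_right _ _)
    have h3 := dist_triangle_right z p y
    linarith
  rw [hF.closure_biUnion] at hcl
  obtain ⟨z, -, hz⟩ := mem_iUnion₂.1 hcl
  exact ⟨z, hz⟩

theorem exists_child_mem_closedCube (hN : IsDyadicNet N x₀ A) (hπ : IsNearest N π)
    (hfin : ∀ k p R, (N k ∩ closedBall p R).Finite) {k : ℤ} {x p : X}
    (hp : p ∈ closedCube N π k x) :
    ∃ w ∈ N (k + 1), π k w = x ∧ p ∈ closedCube N π (k + 1) w := by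
  have hF : {w | w ∈ N (k + 1) ∧ π k w = x}.Finite := by
    refine (hfin (k + 1) x (A ^ (-k))).subset fun w hw => ⟨hw.1, ?_⟩
    rw [mem_closedBall, ← hw.2]
    exact hN.dist_parent_le hπ hw.1
  have hsub : {y | Desc N π k x y} ⊆ ⋃ w ∈ {w | w ∈ N (k + 1) ∧ π k w = x},
      {y | Desc N π (k + 1) w y} := by
    intro y hy
    cases hy with
    | refl hx =>
      exact mem_iUnion₂.2 ⟨x, ⟨hN.subset_succ k hx, hπ.eq_self hx⟩, Desc.refl (hN.subset_succ k hx)⟩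
    | @parent _ w _ hw hd => exact mem_iUnion₂.2 ⟨w, ⟨hw, rfl⟩, hd⟩
  have hcl := closure_mono hsub hp
  rw [hF.closure_biUnion] at hcl
  obtain ⟨w, hw, h⟩ := mem_iUnion₂.1 hcl
  exact ⟨w, hw.1, hw.2, h⟩

theorem InCube.mem_closedCube {k : ℤ} {x p : X} (h : InCube N π e x₀ k x p) :
    p ∈ closedCube N π k x := by
  cases h with
  | base h => exact h
  | child _ _ _ h _ => exact h

theorem InCube.mem (hπ : IsNearest N π) {k : ℤ} {x p : X} (h : InCube N π e x₀ k x p) :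
    x ∈ N k :=
  mem_of_mem_closedCube hπ h.mem_closedCube

theorem IsDyadicNet.closedCube_base_subset (hN : IsDyadicNet N x₀ A) (hπ : IsNearest N π)
    (k : ℤ) : closedCube N π (k + 1) x₀ ⊆ closedCube N π k x₀ := by
  have := closedCube_subset_parent (π := π) (k := k) (hN.base_mem (k + 1))
  rwa [hπ.eq_self (hN.base_mem k)] at this

theorem InCube.eq_base (hN : IsDyadicNet N x₀ A) (hπ : IsNearest N π)
    (he : ∀ k, ∀ x ∈ N k, x ≠ x₀ → e x₀ < e x) {k : ℤ} {x p : X}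
    (h : InCube N π e x₀ k x p) (hp : p ∈ closedCube N π k x₀) : x = x₀ := by
  induction h with
  | base _ => rfl
  | @child k l w p hl hw _ _ hmin ih =>
    subst hl
    by_contra hne
    have h1 := ih (hN.closedCube_base_subset hπ k hp)
    exact hmin x₀ (hN.base_mem _) (by rw [h1, hπ.eq_self (hN.base_mem k)])
      (he _ w hw hne) hp

theorem InCube.unique (hN : IsDyadicNet N x₀ A) (hπ : IsNearest N π)
    (he : ∀ k, ∀ x ∈ N k, x ≠ x₀ → e x₀ < e x) (hinj : ∀ k, InjOn e (N k)) {k : ℤ} {x y p : X}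
    (hx : InCube N π e x₀ k x p) (hy : InCube N π e x₀ k y p) : x = y := by
  induction hx generalizing y with
  | base h => exact (hy.eq_base hN hπ he h).symm
  | @child k l w p hl hw hp hpw hmin ih =>
    cases hy with
    | base h => exact (InCube.child hl hw hp hpw hmin).eq_base hN hπ he h
    | @child k' _ _ _ hl' hw' hp' hpw' hmin' =>
      obtain rfl : k = k' := by lia
      have h1 := ih hp'
      rcases lt_trichotomy (e w) (e y) with h | h | h
      · exact absurd hpw (hmin' w hw h1 h)
      · exact hinj l hw hw' h
      · exact absurd hpw' (hmin y hw' h1.symm h)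

theorem InCube.to_parent (hN : IsDyadicNet N x₀ A) (hπ : IsNearest N π) {k : ℤ} {w p : X}
    (h : InCube N π e x₀ (k + 1) w p) : InCube N π e x₀ k (π k w) p := by
  cases h with
  | base h =>
    rw [hπ.eq_self (hN.base_mem k)]
    exact InCube.base (hN.closedCube_base_subset hπ k h)
  | @child k' _ _ _ hl _ hp _ _ =>
    obtain rfl : k = k' := by lia
    exact hp

theorem InCube.exists_ancestor (hN : IsDyadicNet N x₀ A) (hπ : IsNearest N π) {m n : ℤ}
    (hmn : m ≤ n) (x : X) : ∃ z, ∀ p, InCube N π e x₀ n x p → InCube N π e x₀ m z p := by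
  induction n, hmn using Int.leInduction generalizing x with
  | base => exact ⟨x, fun _ => id⟩
  | succ n _ ih =>
    obtain ⟨z, hz⟩ := ih (π n x)
    exact ⟨z, fun p hp => hz p (hp.to_parent hN hπ)⟩

theorem exists_inCube (hN : IsDyadicNet N x₀ A) (hπ : IsNearest N π) (hA : 3 < A)
    (hfin : ∀ k p R, (N k ∩ closedBall p R).Finite) (k : ℤ) (p : X) :
    ∃ x, InCube N π e x₀ k x p := by
  have hc : 0 < 1 / 2 - 1 / (A - 1) := by
    rw [sub_pos]
    exact one_div_lt_one_div_of_lt two_pos (by linarith)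
  have hA1 : 1 < A := by linarith
  obtain ⟨n, hn⟩ := pow_unbounded_of_one_lt (dist p x₀ / (1 / 2 - 1 / (A - 1))) hA1
  obtain ⟨m, hmk, hstart⟩ : ∃ m ≤ k, InCube N π e x₀ m x₀ p := by
    refine ⟨-(max n (-k).toNat : ℕ), by lia, ?_⟩
    obtain ⟨z, hz⟩ := exists_mem_closedCube hN hπ hA1 hfin (-(max n (-k).toNat : ℕ)) p
    have hzx := eq_of_mem_closedCube_of_mem_ball hN hπ hA1 (hN.base_mem _) (by
      rw [div_lt_iff₀ hc] at hn
      rw [mem_ball, neg_neg, zpow_natCast]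
      have := pow_le_pow_right₀ hA1.le (le_max_left n (-k).toNat)
      nlinarith) hz
    rw [hzx] at hz
    exact InCube.base hz
  induction k, hmk using Int.leInduction with
  | base => exact ⟨x₀, hstart⟩
  | succ k _ ih =>
    obtain ⟨x, hx⟩ := ih
    obtain ⟨w, ⟨hw, hwx, hpw⟩, hmin⟩ := (measure e).wf.has_min
      {w | w ∈ N (k + 1) ∧ π k w = x ∧ p ∈ closedCube N π (k + 1) w}
      (exists_child_mem_closedCube hN hπ hfin hx.mem_closedCube)
    exact ⟨w, InCube.child rfl hw (by rwa [hwx]) hpw fun v hv hvw hlt hpv =>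
      hmin v ⟨hv, hvw.trans hwx, hpv⟩ hlt⟩

theorem inCube_of_mem_ball (hN : IsDyadicNet N x₀ A) (hπ : IsNearest N π) (hA : 3 < A)
    (hfin : ∀ k p R, (N k ∩ closedBall p R).Finite) {k : ℤ} {x p : X} (hx : x ∈ N k)
    (hp : p ∈ ball x ((1 / 2 - 1 / (A - 1)) * A ^ (-k))) : InCube N π e x₀ k x p := by
  obtain ⟨z, hz⟩ := exists_inCube (e := e) hN hπ hA hfin k p
  rwa [← eq_of_mem_closedCube_of_mem_ball hN hπ (by linarith) hx hp hz.mem_closedCube]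

theorem inCube_self (hN : IsDyadicNet N x₀ A) (hπ : IsNearest N π) (hA : 3 < A)
    (hfin : ∀ k p R, (N k ∩ closedBall p R).Finite) {k : ℤ} {x : X} (hx : x ∈ N k) :
    InCube N π e x₀ k x x := by
  refine inCube_of_mem_ball hN hπ hA hfin hx (mem_ball_self ?_)
  have h1 : 1 / (A - 1) < 1 / 2 := one_div_lt_one_div_of_lt two_pos (by linarith)
  exact mul_pos (by linarith) (zpow_pos (by linarith) _)

theorem setOf_inCube_base (k : ℤ) :
    {p | InCube N π e x₀ k x₀ p} = closedCube N π k x₀ :=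
  Subset.antisymm (fun _ h => h.mem_closedCube) fun _ h => InCube.base h

theorem InCube.measurableSet [MeasurableSpace X] [BorelSpace X]
    (hcount : ∀ k, (N k).Countable) {k : ℤ} {x p : X} (h : InCube N π e x₀ k x p) :
    MeasurableSet {q | InCube N π e x₀ k x q} := by
  induction h with
  | base _ =>
    rw [setOf_inCube_base]
    exact isClosed_closure.measurableSet
  | @child k l w _ hl hw _ _ _ ih =>
    by_cases hwx : w = x₀
    · rw [hwx, setOf_inCube_base]
      exact isClosed_closure.measurableSet
    · have hset : {q | InCube N π e x₀ l w q} = {q | InCube N π e x₀ k (π k w) q} ∩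
          closedCube N π l w ∩
          ⋂ v ∈ {v ∈ N l | π k v = π k w ∧ e v < e w}, (closedCube N π l v)ᶜ := by
        ext q
        simp only [mem_inter_iff, mem_iInter, mem_compl_iff, mem_ofPred_eq]
        constructor
        · intro h
          cases h with
          | base _ => exact absurd rfl hwx
          | @child k' _ _ _ hl' _ hp hpw hmin =>
            obtain rfl : k = k' := by lia
            exact ⟨⟨hp, hpw⟩, fun v hv => hmin v hv.1 hv.2.1 hv.2.2⟩
        · rintro ⟨⟨hp, hpw⟩, hmin⟩
          exact InCube.child hl hw hp hpw fun v hv h1 h2 => hmin v ⟨hv, h1, h2⟩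
      rw [hset]
      refine (ih.inter isClosed_closure.measurableSet).inter ?_
      exact MeasurableSet.biInter ((hcount l).mono fun v hv => hv.1) fun v _ =>
        isClosed_closure.measurableSet.compl

theorem exists_second_child (hN : IsDyadicNet N x₀ A) (hπ : IsNearest N π) (hA : 8 ≤ A)
    (hfin : ∀ k p R, (N k ∩ closedBall p R).Finite) {K : ℝ} (hK : IsRBC X K) {k : ℤ} {x y : X}
    (hx : x ∈ N k) (hy : y ∈ N k) (hxy : x ≠ y) : ∃ w ∈ N (k + 1), π k w = x ∧ x ≠ w := by
  have hA1 : 1 < A := by linarith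
  have hp : 0 < A ^ (-k) := zpow_pos (by linarith) _
  obtain ⟨z, hz, hz'⟩ := exists_dist_mem_Ico hK (t := A ^ (-k) / 4) (δ := A ^ (-k) / 20)
    (by positivity) (by positivity) ((hN.separated k hx hy hxy).trans' (by linarith))
  obtain ⟨w, hw⟩ := exists_mem_closedCube hN hπ hA1 hfin (k + 1) z
  have hzw := dist_le_of_mem_closedCube hN hπ hA1 hw
  rw [outer_radius_succ hA1] at hzw
  have h7 : 1 / (A - 1) * A ^ (-k) ≤ 1 / 7 * A ^ (-k) := by
    gcongr
    linarith
  refine ⟨w, mem_of_mem_closedCube hπ hw, ?_, ?_⟩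
  · by_contra hne
    have h1 := half_le_dist hN hπ hx hne
    rw [dist_comm] at h1
    linarith [dist_triangle x z w]
  · rintro rfl
    rw [dist_comm] at hzw
    linarith

theorem IsDyadicNet.subset_of_le (hN : IsDyadicNet N x₀ A) {m n : ℤ} (h : m ≤ n) : N m ⊆ N n := by
  induction n, h using Int.leInduction with
  | base => exact Subset.rfl
  | succ n _ ih => exact ih.trans (hN.subset_succ n)

theorem exists_children_bound (hX : MetricDoubling X) (hN : IsDyadicNet N x₀ A)
    (hπ : IsNearest N π) (hA : 1 < A) :
    ∃ M : ℕ, ∀ k x, {w | w ∈ N (k + 1) ∧ π k w = x}.encard ≤ M := by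
  obtain ⟨M, hM⟩ := exists_packing_bound hX
  obtain ⟨n, hn⟩ := pow_unbounded_of_one_lt (4 * A) one_lt_two
  refine ⟨M ^ n, fun k x => ?_⟩
  have hp : 0 < A ^ (-k) := zpow_pos (by linarith) _
  refine (encard_le_encard fun w hw => ?_).trans
    (hM n x (2 * A ^ (-k)) _ (N (k + 1)) (by positivity) (hN.separated (k + 1)) ?_)
  · refine ⟨hw.1, ?_⟩
    have := hN.dist_parent_le hπ hw.1
    rw [hw.2] at this
    rw [mem_ball]
    linarith
  · rw [zpow_neg_succ hA, ← mul_div_assoc, div_le_div_iff₀ (by positivity) (by linarith)]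
    nlinarith

theorem diam_univ_bounds (hN : IsDyadicNet N x₀ A) (hπ : IsNearest N π) (hA : 3 < A)
    (hfin : ∀ k p R, (N k ∩ closedBall p R).Finite) {k : ℤ} (hk : 1 < (N k).encard)
    (hk' : (N (k - 1)).encard ≤ 1) :
    (1 / 2 - 1 / (A - 1)) * A ^ (-k) ≤ diam (univ : Set X) ∧
      diam (univ : Set X) ≤ 2 * (A / (A - 1)) * A ^ (1 - k) := by
  have hA1 : 0 < A - 1 := by linarith
  have hA0 : 0 < A := by linarith
  have hsub : (univ : Set X) ⊆ closedBall x₀ (A / (A - 1) * A ^ (1 - k)) := by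
    intro p _
    obtain ⟨z, hz⟩ := exists_mem_closedCube hN hπ (by linarith) hfin (k - 1) p
    have := dist_le_of_mem_closedCube hN hπ (by linarith) hz
    rw [encard_le_one_iff.1 hk' z x₀ (mem_of_mem_closedCube hπ hz) (hN.base_mem _), neg_sub]
      at this
    exact this
  constructor
  · obtain ⟨a, b, ha, hb, hab⟩ := one_lt_encard_iff.1 hk
    have h1 := hN.separated k ha hb hab
    have h2 := dist_le_diam_of_mem (isBounded_closedBall.subset hsub) (mem_univ a) (mem_univ b)
    have hp : 0 < A ^ (-k) := zpow_pos (by linarith) _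
    have hq : 0 < 1 / (A - 1) * A ^ (-k) := by positivity
    linarith
  · rw [mul_assoc]
    exact (diam_mono hsub isBounded_closedBall).trans (diam_closedBall (by positivity))

end Cubes

end DyadicCubes

open DyadicCubes

/-- generalized dyadic cubes.  Let `(X,d)` be a complete metric space
that is metric doubling and relatively `K` ball connected for some `K > 1`.  Let `x₀ ∈ X`
and `A ≥ 8`.  Then there is a collection `{Q k i : k ∈ ℤ, i ∈ I k}` of Borel sets,
with centers `xc k i`, satisfying (with `c_A = 1/2 - 1/(A-1)` and `C_A = A/(A-1)`)
properties (a)–(g) of the dyadic-cube decomposition. -/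
theorem generalized_dyadic_cubes
    {X : Type*} [MetricSpace X] [CompleteSpace X]
    (hMD : MetricDoubling X) (K : ℝ) (hK : 1 < K) (hRBC : IsRBC X K)
    (x₀ : X) (A : ℝ) (hA : 8 ≤ A) :
    ∃ (I : ℤ → Set ℕ) (Q : ℤ → ℕ → Set X) (xc : ℤ → ℕ → X),
      -- the cubes are Borel sets
      (∀ k : ℤ, ∀ i ∈ I k, @MeasurableSet X (borel X) (Q k i)) ∧
      -- (a) each generation partitions X
      (∀ k : ℤ, (⋃ i ∈ I k, Q k i) = Set.univ) ∧
      (∀ k : ℤ, ∀ i ∈ I k, ∀ j ∈ I k, i ≠ j → Q k i ∩ Q k j = ∅) ∧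
      -- (b) nesting
      (∀ m n : ℤ, m ≤ n → ∀ i ∈ I n, ∀ j ∈ I m, Q n i ∩ Q m j = ∅ ∨ Q n i ⊆ Q m j) ∧
      -- (c) inner and outer balls around the centers
      (∀ k : ℤ, ∀ i ∈ I k, xc k i ∈ Q k i ∧
        Metric.ball (xc k i) ((1 / 2 - 1 / (A - 1)) * A ^ (-k)) ⊆ Q k i ∧
        Q k i ⊆ closure (Metric.ball (xc k i) ((A / (A - 1)) * A ^ (-k)))) ∧
      -- (d) the nets N_k = {xc k i : i ∈ I k} are increasing and contain x₀
      (∀ k : ℤ, (fun i => xc k i) '' I k ⊆ (fun i => xc (k + 1) i) '' I (k + 1)) ∧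
      (∀ k : ℤ, x₀ ∈ (fun i => xc k i) '' I k) ∧
      -- (e) bounded number of successors; successors' centers are close
      (∃ C_M : ℕ, ∀ k : ℤ, ∀ i ∈ I k,
        {j | j ∈ I (k + 1) ∧ Q (k + 1) j ⊆ Q k i}.encard ≤ (C_M : ℕ∞) ∧
        ∀ j ∈ I (k + 1), Q (k + 1) j ⊆ Q k i →
          dist (xc k i) (xc (k + 1) j) ≤ A ^ (-k)) ∧
      -- (f) the generation k₀ where the decomposition becomes nontrivial
      (∀ k₀ : ℤ, IsLeast {k : ℤ | 1 < (I k).encard} k₀ →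
        (1 / 2 - 1 / (A - 1)) * A ^ (-k₀) ≤ Metric.diam (Set.univ : Set X) ∧
        Metric.diam (Set.univ : Set X) ≤ 2 * (A / (A - 1)) * A ^ (1 - k₀)) ∧
      (∀ k : ℤ, (∃ k' ≤ k, 1 < (I k').encard) → ∀ i ∈ I k,
        2 ≤ {j | j ∈ I (k + 1) ∧ Q (k + 1) j ⊆ Q k i}.encard) ∧
      -- (g) the cubes containing x₀ are compact with center x₀
      (∀ k : ℤ, 0 ∈ I k ∧ IsCompact (Q k 0) ∧ xc k 0 = x₀) := by
  have hA1 : 1 < A := by linarith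
  have hA3 : 3 < A := by linarith
  have := properSpace_of_metricDoubling hMD
  obtain ⟨N, hN⟩ := exists_isDyadicNet x₀ hA1
  have hfin : ∀ k p R, (N k ∩ Metric.closedBall p R).Finite := fun k =>
    finite_inter_closedBall hMD (zpow_pos (by linarith) _) (hN.separated k)
  obtain ⟨π, hπ⟩ := exists_isNearest (fun k => ⟨x₀, hN.base_mem k⟩) hfin
  have hcount : ∀ k, (N k).Countable := fun k => by
    refine (Set.countable_iUnion fun n : ℕ => (hfin k x₀ n).countable).mono fun x hx => ?_
    obtain ⟨n, hn⟩ := exists_nat_ge (dist x x₀)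
    exact Set.mem_iUnion.2 ⟨n, hx, hn⟩
  obtain ⟨e, hinj, he0, he⟩ := exists_label (Set.countable_iUnion hcount) x₀
  have hU : ∀ k, N k ⊆ ⋃ k, N k := Set.subset_iUnion N
  have hinjk : ∀ k, Set.InjOn e (N k) := fun k => hinj.mono (hU k)
  have hek : ∀ k, ∀ x ∈ N k, x ≠ x₀ → e x₀ < e x := fun _ x _ => he x
  have : Nonempty X := ⟨x₀⟩
  let c : ℕ → X := Function.invFunOn e (⋃ k, N k)
  have hc : ∀ k, ∀ x ∈ N k, c (e x) = x := fun k x hx =>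
    hinj.leftInvOn_invFunOn (hU k hx)
  have hnet : ∀ k, c '' (e '' N k) = N k := fun k => by
    rw [Set.image_image]
    exact (Set.image_congr (hc k)).trans (Set.image_id' _)
  have hcard : ∀ k, (e '' N k).encard = (N k).encard := fun k => (hinjk k).encard_image
  let Q : ℤ → X → Set X := fun k x => {p | InCube N π e x₀ k x p}
  have hself : ∀ k, ∀ x ∈ N k, x ∈ Q k x := fun k x hx => inCube_self hN hπ hA3 hfin hx
  have hchild : ∀ k, ∀ x ∈ N k, ∀ w ∈ N (k + 1), Q (k + 1) w ⊆ Q k x ↔ π k w = x := by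
    intro k x _ w hw
    constructor
    · intro h
      exact ((hself _ w hw).to_parent hN hπ).unique hN hπ hek hinjk (h (hself _ w hw))
    · rintro rfl p hp
      exact hp.to_parent hN hπ
  have hchildren : ∀ k, ∀ x ∈ N k,
      {j | j ∈ e '' N (k + 1) ∧ Q (k + 1) (c j) ⊆ Q k (c (e x))} =
        e '' {w | w ∈ N (k + 1) ∧ π k w = x} := by
    intro k x hx
    rw [hc k x hx]
    ext j
    constructor
    · rintro ⟨⟨w, hw, rfl⟩, h⟩
      rw [hc _ w hw, hchild k x hx w hw] at h
      exact ⟨w, ⟨hw, h⟩, rfl⟩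
    · rintro ⟨w, ⟨hw, h⟩, rfl⟩
      refine ⟨⟨w, hw, rfl⟩, ?_⟩
      rwa [hc _ w hw, hchild k x hx w hw]
  have hchildren_card : ∀ k, ∀ x ∈ N k,
      {j | j ∈ e '' N (k + 1) ∧ Q (k + 1) (c j) ⊆ Q k (c (e x))}.encard =
        {w | w ∈ N (k + 1) ∧ π k w = x}.encard := by
    intro k x hx
    rw [hchildren k x hx]
    exact ((hinjk (k + 1)).mono fun w hw => hw.1).encard_image
  refine ⟨fun k => e '' N k, fun k i => Q k (c i), fun _ => c, ?_, ?_, ?_, ?_, ?_, ?_, ?_, ?_,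
    ?_, ?_, ?_⟩ <;> beta_reduce
  · rintro k _ ⟨x, hx, rfl⟩
    rw [hc k x hx]
    borelize X
    exact InCube.measurableSet hcount (hself k x hx)
  · intro k
    refine Set.eq_univ_of_forall fun p => ?_
    obtain ⟨x, hx⟩ := exists_inCube (e := e) hN hπ hA3 hfin k p
    refine Set.mem_iUnion₂.2 ⟨e x, ⟨x, hx.mem hπ, rfl⟩, ?_⟩
    rwa [hc k x (hx.mem hπ)]
  · rintro k _ ⟨x, hx, rfl⟩ _ ⟨y, hy, rfl⟩ hne
    rw [hc k x hx, hc k y hy]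
    refine Set.eq_empty_of_forall_notMem fun p hp => hne ?_
    rw [InCube.unique hN hπ hek hinjk hp.1 hp.2]
  · intro m n hmn i _ j _
    refine or_iff_not_imp_left.2 fun hne => ?_
    obtain ⟨p, hp, hp'⟩ := Set.nonempty_iff_ne_empty.2 hne
    obtain ⟨z, hz⟩ := InCube.exists_ancestor (e := e) hN hπ hmn (c i)
    rw [← (hz p hp).unique hN hπ hek hinjk hp']
    exact hz
  · rintro k _ ⟨x, hx, rfl⟩
    rw [hc k x hx]
    exact ⟨hself k x hx, fun p hp => inCube_of_mem_ball hN hπ hA3 hfin hx hp,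
      fun p hp => closedCube_subset hN hπ hA1 k x hp.mem_closedCube⟩
  · intro k
    rw [hnet, hnet]
    exact hN.subset_succ k
  · intro k
    rw [hnet]
    exact hN.base_mem k
  · obtain ⟨M, hM⟩ := exists_children_bound hMD hN hπ hA1
    refine ⟨M, ?_⟩
    rintro k _ ⟨x, hx, rfl⟩
    refine ⟨(hchildren_card k x hx).trans_le (hM k x), ?_⟩
    rintro _ ⟨w, hw, rfl⟩ hsub
    rw [hc k x hx, hc _ w hw, hchild k x hx w hw] at hsub
    rw [hc k x hx, hc _ w hw, dist_comm, ← hsub]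
    exact hN.dist_parent_le hπ hw
  · rintro k₀ ⟨hk, hmin⟩
    refine diam_univ_bounds hN hπ hA3 hfin ((hcard k₀).symm.trans_gt hk) ?_
    by_contra! h
    have := hmin (show 1 < (e '' N (k₀ - 1)).encard by rwa [hcard])
    lia
  · rintro k ⟨k', hk', hcard'⟩ _ ⟨x, hx, rfl⟩
    rw [hchildren_card k x hx]
    rw [hcard] at hcard'
    obtain ⟨y, hy, hxy⟩ := Set.exists_ne_of_one_lt_encard
      (hcard'.trans_le (Set.encard_le_encard (hN.subset_of_le hk'))) x
    obtain ⟨w, hw, hwx, hne⟩ := exists_second_child hN hπ hA hfin hRBC hx hy hxy.symm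
    rw [← Set.encard_pair hne]
    refine Set.encard_le_encard (Set.insert_subset ⟨hN.subset_succ k hx, hπ.eq_self hx⟩ ?_)
    exact Set.singleton_subset_iff.2 ⟨hw, hwx⟩
  · intro k
    have hx := hN.base_mem k
    have hc0 : c 0 = x₀ := by rw [← he0, hc k x₀ hx]
    refine ⟨⟨x₀, hx, he0⟩, ?_, hc0⟩
    simp only [hc0, Q, setOf_inCube_base]
    exact (isCompact_closedBall x₀ _).of_isClosed_subset isClosed_closure
      fun p hp => dist_le_of_mem_closedCube hN hπ hA1 hp
end

section
/- Let (X,d) be a complete metric space that is relatively K ball connected for some K > 1. Then for every x₀ ∈ X and R > 0 with B(x₀,R) ≠ X, the set { d(x₀,x) : x ∈ B(x₀,R) } equals the interval [0,R). Consequently, r ≤ diam(B(x,r), d) ≤ 2r for every x ∈ X and r > 0 with B(x,r) ≠ X. -/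
open Filter Topology

/-- A chain that starts below the level `r` and ends at or above it crosses `r` in one step. -/
lemma exists_step_crossing {α : Type*} [LinearOrder α] (u : ℕ → α) (r : α) (N : ℕ)
    (h0 : u 0 < r) (hN : r ≤ u N) : ∃ i < N, u i < r ∧ r ≤ u (i + 1) := by
  by_contra! h
  have key : ∀ i ≤ N, u i < r := by
    intro i
    induction i with
    | zero => exact fun _ => h0
    | succ i ih => exact fun hi => h i hi (ih (by omega))
  exact absurd hN (key N le_rfl).not_ge

/-- The chain condition refines a crossing pair at scale `t` to one at scale `ε * t` nearby. -/
lemma ChainCond.exists_finer_crossing {X : Type*} [MetricSpace X] {ε K : ℝ} {N : ℕ}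
    (h : ChainCond X ε K N) (hε : 0 < ε) (f : X → ℝ) {r t : ℝ} {a b : X}
    (ha : f a < r) (hb : r ≤ f b) (hab : dist a b < t) :
    ∃ a' b', f a' < r ∧ r ≤ f b' ∧ dist a' b' < ε * t ∧ dist a a' < K * t := by
  have ht : 0 < t := dist_nonneg.trans_lt hab
  obtain ⟨z, hz0, hzN, hball, hstep⟩ := h a t ht a (subset_closure (Metric.mem_ball_self ht)) b
    (subset_closure (Metric.mem_ball'.2 hab))
  obtain ⟨i, hi, hi1, hi2⟩ := exists_step_crossing (fun i => f (z i)) r N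
    (by simpa [hz0] using ha) (by simpa [hzN] using hb)
  refine ⟨z i, z (i + 1), hi1, hi2, by simpa using hstep (i + 1) (by omega) hi, ?_⟩
  exact Metric.mem_ball'.1 (hball i hi.le (Metric.mem_ball_self (mul_pos hε ht)))

/-- The intermediate value property for continuous functions on a complete space satisfying the
chain condition at scale `1 / 2`. -/
lemma ChainCond.exists_eq_of_continuous {X : Type*} [MetricSpace X] [CompleteSpace X] {K : ℝ}
    {N : ℕ} (h : ChainCond X (1 / 2) K N) {f : X → ℝ} (hf : Continuous f) {r : ℝ} {a b : X}
    (ha : f a < r) (hb : r ≤ f b) : ∃ x, f x = r := by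
  let s := dist a b + 1
  let Good : ℕ → X × X → Prop := fun n p => f p.1 < r ∧ r ≤ f p.2 ∧ dist p.1 p.2 < s / 2 ^ n
  have step : ∀ n p, ∃ q, Good n p → Good (n + 1) q ∧ dist p.1 q.1 < K * (s / 2 ^ n) := by
    intro n p
    by_cases hp : Good n p
    · obtain ⟨a', b', h1, h2, h3, h4⟩ :=
        h.exists_finer_crossing (by norm_num) f hp.1 hp.2.1 hp.2.2
      refine ⟨(a', b'), fun _ => ⟨⟨h1, h2, h3.trans_eq ?_⟩, h4⟩⟩
      rw [pow_succ]
      field_simp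
    · exact ⟨p, fun hp' => absurd hp' hp⟩
  choose g hg using step
  let u : ℕ → X × X := fun n => Nat.rec (a, b) g n
  have hu : ∀ n, Good n (u n) := by
    intro n
    induction n with
    | zero => exact ⟨ha, hb, by simp [u, s]⟩
    | succ n ih => exact (hg n (u n) ih).1
  have hdist : ∀ n, dist (u n).1 (u (n + 1)).1 ≤ 2 * K * s / 2 / 2 ^ n := fun n =>
    ((hg n (u n) (hu n)).2.trans_eq (by ring)).le
  obtain ⟨x, hx⟩ := cauchySeq_tendsto_of_complete (cauchySeq_of_le_geometric_two hdist)
  have hs : Tendsto (fun n : ℕ => s / 2 ^ n) atTop (𝓝 0) :=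
    tendsto_const_nhds.div_atTop (tendsto_pow_atTop_atTop_of_one_lt one_lt_two)
  have hx' : Tendsto (fun n => (u n).2) atTop (𝓝 x) :=
    hx.congr_dist (squeeze_zero (fun _ => dist_nonneg) (fun n => (hu n).2.2.le) hs)
  exact ⟨x, le_antisymm
    (le_of_tendsto' ((hf.tendsto x).comp hx) fun n => (hu n).1.le)
    (ge_of_tendsto' ((hf.tendsto x).comp hx') fun n => (hu n).2.1)⟩


/-- Let `(X,d)` be a complete metric space that is relatively `K` ball
connected for some `K > 1`.  Then for every `x₀ ∈ X` and `R > 0` with `B(x₀,R) ≠ X`, the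
set of distances `{ d(x₀,x) : x ∈ B(x₀,R) }` is exactly the interval `[0,R)`.
Consequently, `r ≤ diam (B(x,r)) ≤ 2r` whenever `r > 0` and `B(x,r) ≠ X`. -/
theorem rbc_distance_range
    {X : Type*} [MetricSpace X] [CompleteSpace X]
    (K : ℝ) (hK : 1 < K) (hRBC : IsRBC X K) :
    (∀ (x₀ : X) (R : ℝ), 0 < R → Metric.ball x₀ R ≠ Set.univ →
      (fun x => dist x₀ x) '' Metric.ball x₀ R = Set.Ico 0 R) ∧
    (∀ (x : X) (r : ℝ), 0 < r → Metric.ball x r ≠ Set.univ →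
      r ≤ Metric.diam (Metric.ball x r) ∧ Metric.diam (Metric.ball x r) ≤ 2 * r) := by
  obtain ⟨N, hN⟩ := hRBC (1 / 2) ⟨by norm_num, by norm_num⟩
  have range_eq : ∀ (x₀ : X) (R : ℝ), 0 < R → Metric.ball x₀ R ≠ Set.univ →
      (fun x => dist x₀ x) '' Metric.ball x₀ R = Set.Ico 0 R := by
    intro x₀ R hR hne
    obtain ⟨y, hy⟩ := (Set.ne_univ_iff_exists_notMem _).1 hne
    rw [Metric.mem_ball', not_lt] at hy
    ext t
    constructor
    · rintro ⟨x, hx, rfl⟩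
      exact ⟨dist_nonneg, Metric.mem_ball'.1 hx⟩
    · rintro ⟨ht0, htR⟩
      rcases ht0.eq_or_lt with rfl | ht
      · exact ⟨x₀, Metric.mem_ball_self hR, dist_self x₀⟩
      · obtain ⟨x, hx⟩ := hN.exists_eq_of_continuous (f := fun x => dist x₀ x) (a := x₀)
          (by fun_prop) (by simpa using ht) (htR.le.trans hy)
        exact ⟨x, Metric.mem_ball'.2 (hx.trans_lt htR), hx⟩
  refine ⟨range_eq, fun x r hr hne => ⟨le_of_forall_lt_imp_le_of_dense fun t ht => ?_,
    Metric.diam_ball hr.le⟩⟩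
  rcases lt_or_ge t 0 with ht0 | ht0
  · exact ht0.le.trans Metric.diam_nonneg
  · obtain ⟨y, hy, rfl⟩ := (range_eq x r hr hne).ge ⟨ht0, ht⟩
    exact Metric.dist_le_diam_of_mem Metric.isBounded_ball (Metric.mem_ball_self hr) hy
end
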